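/- Let K ⊆ L be a field extension such that L^{G(L|K)} = K, and put T = K + X·L[X]. If T is a Noetherian ring, then K ⊆ L is a Galois extension (normal and separable). -/

import Mathlib

/-- The polynomial composite `K + X·L[X]`: the subring of `L[X]` consisting of
all polynomials whose constant term lies in (the image of) `K`. -/
def polynomialComposite (K L : Type*) [Field K] [Field L] [Algebra K L] :
    Subring (Polynomial L) where
  carrier := {p | p.coeff 0 ∈ (algebraMap K L).range}
  mul_mem' := by
    intro a b ha hb
    simp only [Set.mem_setOf_eq, Polynomial.mul_coeff_zero] at *
    exact mul_mem ha hb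
  one_mem' := by simp
  add_mem' := by
    intro a b ha hb
    simp only [Set.mem_setOf_eq, Polynomial.coeff_add] at *
    exact add_mem ha hb
  zero_mem' := by simp
  neg_mem' := by
    intro a ha
    simp only [Set.mem_setOf_eq, Polynomial.coeff_neg] at *
    exact neg_mem ha


/-- The ideal of `K + X·L[X]` of polynomials without constant term whose linear coefficient lies
in a given `K`-subspace of `L`. -/
def linearCoeffIdeal {K L : Type*} [Field K] [Field L] [Algebra K L] (W : Submodule K L) :
    Ideal (polynomialComposite K L) where
  carrier := {p | (p : Polynomial L).coeff 0 = 0 ∧ (p : Polynomial L).coeff 1 ∈ W}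
  zero_mem' := by simp
  add_mem' := by
    rintro p q ⟨hp₀, hp₁⟩ ⟨hq₀, hq₁⟩
    exact ⟨by simp [hp₀, hq₀], by simpa using add_mem hp₁ hq₁⟩
  smul_mem' := by
    rintro ⟨t, k, hk⟩ p ⟨hp₀, hp₁⟩
    refine ⟨by simp [Polynomial.mul_coeff_zero, hp₀], ?_⟩
    simpa [Polynomial.mul_coeff_one, hp₀, ← hk, Algebra.smul_def] using W.smul_mem k hp₁

theorem mem_linearCoeffIdeal {K L : Type*} [Field K] [Field L] [Algebra K L]
    {W : Submodule K L} {p : polynomialComposite K L} :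
    p ∈ linearCoeffIdeal W ↔
      (p : Polynomial L).coeff 0 = 0 ∧ (p : Polynomial L).coeff 1 ∈ W :=
  Iff.rfl

theorem linearCoeffIdeal_le_iff {K L : Type*} [Field K] [Field L] [Algebra K L]
    {V W : Submodule K L} : linearCoeffIdeal V ≤ linearCoeffIdeal W ↔ V ≤ W := by
  refine ⟨fun h a ha ↦ ?_, fun h p hp ↦ ⟨hp.1, h hp.2⟩⟩
  have hmem : Polynomial.C a * Polynomial.X ∈ polynomialComposite K L :=
    ⟨0, by simp⟩
  have := @h ⟨_, hmem⟩ (mem_linearCoeffIdeal.2 ⟨by simp, by simpa using ha⟩)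
  simpa using (mem_linearCoeffIdeal.1 this).2

theorem finiteDimensional_of_isNoetherianRing_polynomialComposite
    (K L : Type*) [Field K] [Field L] [Algebra K L]
    (hT : IsNoetherianRing (polynomialComposite K L)) : FiniteDimensional K L := by
  have : WellFoundedGT (Ideal (polynomialComposite K L)) := inferInstance
  have : WellFoundedGT (Submodule K L) :=
    (OrderEmbedding.ofMapLEIff linearCoeffIdeal
      fun _ _ ↦ linearCoeffIdeal_le_iff).strictMono.wellFoundedGT
  have : IsNoetherian K L := isNoetherian_iff'.2 this
  infer_instance

theorem galois_of_composite_noetherian_of_fixedField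
    (K L : Type*) [Field K] [Field L] [Algebra K L]
    (hfix : ∀ x : L, (∀ σ : L ≃ₐ[K] L, σ x = x) → x ∈ (algebraMap K L).range)
    (hT : IsNoetherianRing (polynomialComposite K L)) :
    IsGalois K L := by
  have := finiteDimensional_of_isNoetherianRing_polynomialComposite K L hT
  refine IsGalois.of_fixedField_eq_bot K L (eq_bot_iff.2 fun x hx ↦ ?_)
  exact IntermediateField.mem_bot.2 (hfix x fun σ ↦ hx ⟨σ, Subgroup.mem_top σ⟩)
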